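/- Let T_1[M_1] and T_2[M_2] be multiply annotated type graphs over B^n, let T_1 × T_2 be the product graph with projections π_1, π_2, and let N be the set of all pairs (ℓ,u) of annotations of T_1 × T_2 with ℓ ≤ u such that π_1 is a legal morphism (T_1 × T_2)[{(ℓ,u)}] → T_1[M_1] and π_2 is a legal morphism (T_1 × T_2)[{(ℓ,u)}] → T_2[M_2]. Then L((T_1 × T_2)[N]) = L(T_1[M_1]) ∩ L(T_2[M_2]); i.e., languages of multiply annotated type graphs are closed under intersection. -/

import Mathlib

/-- A `Λ`-labeled graph: finite sets of nodes and edges, with source/target maps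
and an edge labeling. -/
structure LGraph (Λ : Type) : Type 1 where
  V : Type
  E : Type
  finV : Finite V
  finE : Finite E
  src : E → V
  tgt : E → V
  lab : E → Λ

/-- A morphism of `Λ`-labeled graphs: maps on nodes and edges commuting with
source and target and preserving labels. -/
structure LGraph.Hom {Λ : Type} (G H : LGraph Λ) : Type where
  fV : G.V → H.V
  fE : G.E → H.E
  src_comm : ∀ e, H.src (fE e) = fV (G.src e)
  tgt_comm : ∀ e, H.tgt (fE e) = fV (G.tgt e)
  lab_comm : ∀ e, H.lab (fE e) = G.lab e

/-- Composition of graph morphisms. -/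
def LGraph.Hom.comp {Λ : Type} {G H K : LGraph Λ} (ψ : LGraph.Hom H K)
    (φ : LGraph.Hom G H) : LGraph.Hom G K where
  fV := ψ.fV ∘ φ.fV
  fE := ψ.fE ∘ φ.fE
  src_comm e := by simp [Function.comp_apply, ψ.src_comm, φ.src_comm]
  tgt_comm e := by simp [Function.comp_apply, ψ.tgt_comm, φ.tgt_comm]
  lab_comm e := by simp [Function.comp_apply, ψ.lab_comm, φ.lab_comm]

/-- `G → H`: there exists some graph morphism from `G` to `H`. -/
def LGraph.Arrow {Λ : Type} (G H : LGraph Λ) : Prop := Nonempty (LGraph.Hom G H)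

/-- The type graph language `L(T) = {G | G → T}`. -/
def TGLang {Λ : Type} (T : LGraph Λ) : Set (LGraph Λ) := {G | LGraph.Arrow G T}

/-- The restriction graph language `L_R(R) = {G | R ↛ G}`. -/
def RGLang {Λ : Type} (R : LGraph Λ) : Set (LGraph Λ) := {G | ¬ LGraph.Arrow R G}

/-- An annotation of a graph `G` over `B^n`: a function from the items (nodes and
edges) of `G` to the ℓ-monoid `M_n = {0,1,…,n,m}`, where `m` is represented by `n+1`.
The order is the pointwise one. -/
abbrev Ann {Λ : Type} (n : ℕ) (G : LGraph Λ) : Type := (G.V ⊕ G.E) → Fin (n + 2)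

/-- The action of a graph morphism on items. -/
def LGraph.Hom.itemMap {Λ : Type} {G H : LGraph Λ} (φ : LGraph.Hom G H) :
    (G.V ⊕ G.E) → (H.V ⊕ H.E) := Sum.map φ.fV φ.fE

/-- Truncation into `M_n = {0,…,n,m}`: any value exceeding `n` becomes `m` (= `n+1`). -/
def truncate (n k : ℕ) : Fin (n + 2) := ⟨min k (n + 1), by omega⟩

/-- The pushforward annotation `B^n_φ(a)`: each item `y` of the target receives the
(truncated) sum of `a x` over all items `x` with `φ(x) = y`. -/
noncomputable def pushAnn {Λ : Type} {n : ℕ} {G H : LGraph Λ}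
    (φ : LGraph.Hom G H) (a : Ann n G) : Ann n H :=
  fun y => truncate n (∑ᶠ x ∈ {x | φ.itemMap x = y}, ((a x : ℕ)))

/-- The standard annotation `s_G`, mapping every node and edge of `G` to `1`. -/
def stdAnn {Λ : Type} (n : ℕ) (G : LGraph Λ) : Ann n G := fun _ => 1

/-- `φ : T1[M1] → T2[M2]` is a legal morphism if for every `(ℓ,u) ∈ M1` there is
`(ℓ',u') ∈ M2` with `ℓ' ≤ B^n_φ(ℓ)` and `B^n_φ(u) ≤ u'`. -/
def Legal {Λ : Type} {n : ℕ} {T1 T2 : LGraph Λ}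
    (M1 : Set (Ann n T1 × Ann n T1)) (M2 : Set (Ann n T2 × Ann n T2))
    (φ : LGraph.Hom T1 T2) : Prop :=
  ∀ p ∈ M1, ∃ q ∈ M2, q.1 ≤ pushAnn φ p.1 ∧ pushAnn φ p.2 ≤ q.2

/-- The language of the multiply annotated type graph `T[M]`: all graphs `G` such
that there is a morphism `φ : G → T` and a pair `(ℓ,u) ∈ M` with
`ℓ ≤ B^n_φ(s_G) ≤ u`. -/
def AnnLang {Λ : Type} {n : ℕ} (T : LGraph Λ) (M : Set (Ann n T × Ann n T)) :
    Set (LGraph Λ) :=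
  {G | ∃ φ : LGraph.Hom G T, ∃ p ∈ M,
      p.1 ≤ pushAnn φ (stdAnn n G) ∧ pushAnn φ (stdAnn n G) ≤ p.2}

/-- The product graph `T1 × T2`. -/
def prodGraph {Λ : Type} (T1 T2 : LGraph Λ) : LGraph Λ where
  V := T1.V × T2.V
  E := {p : T1.E × T2.E // T1.lab p.1 = T2.lab p.2}
  finV := by have := T1.finV; have := T2.finV; exact inferInstance
  finE := by have := T1.finE; have := T2.finE; exact inferInstance
  src p := (T1.src p.1.1, T2.src p.1.2)
  tgt p := (T1.tgt p.1.1, T2.tgt p.1.2)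
  lab p := T1.lab p.1.1

/-- The first projection `π₁ : T1 × T2 → T1`. -/
def prodProj1 {Λ : Type} (T1 T2 : LGraph Λ) : LGraph.Hom (prodGraph T1 T2) T1 where
  fV := Prod.fst
  fE e := e.1.1
  src_comm _ := rfl
  tgt_comm _ := rfl
  lab_comm _ := rfl

/-- The second projection `π₂ : T1 × T2 → T2`. -/
def prodProj2 {Λ : Type} (T1 T2 : LGraph Λ) : LGraph.Hom (prodGraph T1 T2) T2 where
  fV := Prod.snd
  fE e := e.1.2
  src_comm _ := rfl
  tgt_comm _ := rfl
  lab_comm e := e.2.symm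

theorem min_sum_min {ι : Type} (s : Finset ι) (f : ι → ℕ) (N : ℕ) :
    min (∑ i ∈ s, min (f i) N) N = min (∑ i ∈ s, f i) N := by
  classical
  induction s using Finset.induction_on with
  | empty => simp
  | insert a s ha ih =>
    rw [Finset.sum_insert ha, Finset.sum_insert ha]
    omega

open Classical in
theorem pushAnn_val {Λ : Type} {n : ℕ} {G H : LGraph Λ} [Fintype (G.V ⊕ G.E)]
    (φ : LGraph.Hom G H) (a : Ann n G) (y : H.V ⊕ H.E) :
    (pushAnn φ a y : ℕ) =
      min (∑ x ∈ Finset.univ.filter (fun x => φ.itemMap x = y), (a x : ℕ)) (n + 1) := by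
  have h : ∑ᶠ x ∈ {x | φ.itemMap x = y}, ((a x : ℕ)) =
      ∑ x ∈ Finset.univ.filter (fun x => φ.itemMap x = y), (a x : ℕ) := by
    rw [← finsum_mem_coe_finset]
    simp
  simp only [pushAnn, truncate]
  rw [h]

theorem pushAnn_mono {Λ : Type} {n : ℕ} {G H : LGraph Λ}
    (φ : LGraph.Hom G H) {a b : Ann n G} (hab : a ≤ b) : pushAnn φ a ≤ pushAnn φ b := by
  classical
  have := G.finV
  have := G.finE
  have := Fintype.ofFinite (G.V ⊕ G.E)
  intro y
  rw [Fin.le_def, pushAnn_val, pushAnn_val]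
  exact min_le_min (Finset.sum_le_sum fun x _ => hab x) le_rfl

theorem pushAnn_comp {Λ : Type} {n : ℕ} {G H K : LGraph Λ}
    (ψ : LGraph.Hom H K) (φ : LGraph.Hom G H) (a : Ann n G) :
    pushAnn ψ (pushAnn φ a) = pushAnn (ψ.comp φ) a := by
  classical
  have := G.finV
  have := G.finE
  have := H.finV
  have := H.finE
  have := Fintype.ofFinite (G.V ⊕ G.E)
  have := Fintype.ofFinite (H.V ⊕ H.E)
  have hc : ∀ x, (ψ.comp φ).itemMap x = ψ.itemMap (φ.itemMap x) := by
    rintro (x | x) <;> rfl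
  funext z
  apply Fin.ext
  rw [pushAnn_val, pushAnn_val]
  simp only [pushAnn_val]
  rw [min_sum_min]
  congr 1
  rw [← Finset.sum_fiberwise_of_maps_to
    (s := Finset.univ.filter fun x => (ψ.comp φ).itemMap x = z)
    (t := Finset.univ.filter fun y => ψ.itemMap y = z) (g := φ.itemMap)
    (by intro x hx; simpa [hc] using hx)]
  apply Finset.sum_congr rfl
  intro y hy
  apply Finset.sum_congr _ (fun _ _ => rfl)
  ext x
  simp only [Finset.mem_filter, Finset.mem_univ, true_and] at hy ⊢
  constructor
  · intro h
    exact ⟨by rw [hc, h, hy], h⟩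
  · exact fun h => h.2

/-- The pairing of two morphisms into the product graph. -/
def prodPair {Λ : Type} {G T1 T2 : LGraph Λ} (φ : LGraph.Hom G T1) (ψ : LGraph.Hom G T2) :
    LGraph.Hom G (prodGraph T1 T2) where
  fV x := (φ.fV x, ψ.fV x)
  fE e := ⟨(φ.fE e, ψ.fE e), (φ.lab_comm e).trans (ψ.lab_comm e).symm⟩
  src_comm e := Prod.ext (φ.src_comm e) (ψ.src_comm e)
  tgt_comm e := Prod.ext (φ.tgt_comm e) (ψ.tgt_comm e)
  lab_comm e := φ.lab_comm e

/-- Intersection of languages of multiply annotated type graphs: taking on the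
product graph all annotation pairs `(ℓ,u)` with `ℓ ≤ u` making both projections
legal, `L((T1 × T2)[N]) = L(T1[M1]) ∩ L(T2[M2])`. -/
theorem annLang_inter {Λ : Type} {n : ℕ} (hn : 1 ≤ n) (T1 T2 : LGraph Λ)
    (M1 : Set (Ann n T1 × Ann n T1)) (M2 : Set (Ann n T2 × Ann n T2))
    (hM1 : ∀ p ∈ M1, p.1 ≤ p.2) (hM2 : ∀ p ∈ M2, p.1 ≤ p.2) :
    AnnLang (prodGraph T1 T2)
      {p : Ann n (prodGraph T1 T2) × Ann n (prodGraph T1 T2) |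
        p.1 ≤ p.2 ∧ Legal {p} M1 (prodProj1 T1 T2) ∧ Legal {p} M2 (prodProj2 T1 T2)} =
      AnnLang T1 M1 ∩ AnnLang T2 M2 := by
  ext G
  constructor
  · rintro ⟨φ, p, ⟨-, h1, h2⟩, hl, hu⟩
    obtain ⟨q1, hq1, hl1, hu1⟩ := h1 p rfl
    obtain ⟨q2, hq2, hl2, hu2⟩ := h2 p rfl
    refine ⟨⟨(prodProj1 T1 T2).comp φ, q1, hq1, ?_, ?_⟩,
      ⟨(prodProj2 T1 T2).comp φ, q2, hq2, ?_, ?_⟩⟩ <;> rw [← pushAnn_comp]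
    · exact hl1.trans (pushAnn_mono _ hl)
    · exact (pushAnn_mono _ hu).trans hu1
    · exact hl2.trans (pushAnn_mono _ hl)
    · exact (pushAnn_mono _ hu).trans hu2
  · rintro ⟨⟨φ, p, hp, hpl, hpu⟩, ⟨ψ, q, hq, hql, hqu⟩⟩
    have e1 : (prodProj1 T1 T2).comp (prodPair φ ψ) = φ := rfl
    have e2 : (prodProj2 T1 T2).comp (prodPair φ ψ) = ψ := rfl
    refine ⟨prodPair φ ψ, (pushAnn (prodPair φ ψ) (stdAnn n G),
      pushAnn (prodPair φ ψ) (stdAnn n G)), ⟨le_rfl, ?_, ?_⟩, le_rfl, le_rfl⟩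
    · rintro _ rfl
      refine ⟨p, hp, ?_, ?_⟩ <;> simpa only [pushAnn_comp, e1]
    · rintro _ rfl
      refine ⟨q, hq, ?_, ?_⟩ <;> simpa only [pushAnn_comp, e2]
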